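/- For all integers 1 ≤ j < g: σ ∘ ℒ^{(g)} = ℒ^{(j)} ∘ σ, and σ ∘ ℬ^{(g)}_{2k+1} = ℬ^{(j)}_{2k+1} ∘ σ for every k with 1 ≤ k ≤ j; that is, the Buchstaber–Shorina polynomial differential operators ℒ and ℬ_{2k+1} (k ≤ j) defined for genus g, when restricted to the coordinate subspace ℂ^{3j} ⊂ ℂ^{3g}, coincide with the corresponding operators defined for genus j. -/

import Mathlib

open MvPolynomial

noncomputable section

/-- B_g = ℂ[b_{i,j} : i ∈ {1,2,3}, j odd, 1 ≤ j ≤ 2g−1], as a polynomial ring in 3g variables;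
the variable (i, m) : Fin 3 × Fin g stands for b_{i+1, 2m+1}. -/
abbrev Bg (g : ℕ) : Type := MvPolynomial (Fin 3 × Fin g) ℂ

/-- `bb g i m` is the variable b_{i, 2m−1} (zero if i ∉ {1,2,3} or m ∉ {1,…,g}). -/
noncomputable def bb (g : ℕ) (i m : ℕ) : Bg g :=
  if h : 1 ≤ i ∧ i ≤ 3 ∧ 1 ≤ m ∧ m ≤ g then
    MvPolynomial.X (⟨i - 1, by omega⟩, ⟨m - 1, by omega⟩) else 0

/-- `bv g i j` is the variable b_{i,j} for odd j (zero for j > 2g−1). -/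
noncomputable def bv (g : ℕ) (i j : ℕ) : Bg g :=
  if Odd j then bb g i ((j + 1) / 2) else 0

/-- `Qg g a c` is p_{2a−1, 2c−1} for 1 ≤ a ≤ c, by the elimination recursion. -/
noncomputable def Qg (g : ℕ) : ℕ → ℕ → Bg g
  | 0, _ => 0
  | 1, c => 2 * bb g 1 c
  | 2, c => 6 * bb g 1 1 * bb g 1 c - bb g 3 c + 6 * bb g 1 (c + 1)
  | 3, c => bb g 3 1 * bb g 1 c - bb g 2 1 * bb g 2 c + bb g 1 1 * bb g 3 c
      - 2 * (4 * bb g 1 1 ^ 2 + bb g 1 2) * bb g 1 c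
      + 10 * bb g 1 1 * bb g 1 (c + 1) - 2 * bb g 3 (c + 1) + 10 * bb g 1 (c + 2)
  | (a + 4), c => 2 * (if c + 1 ≤ g then Qg g (a + 3) (c + 1) else 0)
      - (if c + 2 ≤ g then Qg g (a + 2) (c + 2) else 0)
      - 8 * bb g 1 1 * bb g 1 (a + 2) * bb g 1 c - 2 * bb g 1 c * bb g 1 (a + 3)
      - 2 * bb g 1 (a + 2) * bb g 1 (c + 1) + bb g 1 (a + 2) * bb g 3 c
      - bb g 2 (a + 2) * bb g 2 c + bb g 3 (a + 2) * bb g 1 c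

/-- `pp g k l` is p_{k,l} for odd k, l (zero if k > 2g−1 or l > 2g−1). -/
noncomputable def pp (g : ℕ) (k l : ℕ) : Bg g :=
  if Odd k ∧ Odd l ∧ k ≤ 2 * g - 1 ∧ l ≤ 2 * g - 1 then
    if k ≤ l then Qg g ((k + 1) / 2) ((l + 1) / 2) else Qg g ((l + 1) / 2) ((k + 1) / 2)
  else 0

/-- 𝐛ᵢ(ξ) = Σ_{m=1}^{g} b_{i,2m−1} ξᵐ ∈ B_g[ξ]. -/
noncomputable def Bcoef (g i : ℕ) : Polynomial (Bg g) :=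
  ∑ m ∈ Finset.Icc 1 g, Polynomial.C (bb g i m) * Polynomial.X ^ m

/-- The polynomial ξ𝐛₂(ξ)² + 2ξ𝐛₃(ξ)(1 − 𝐛₁(ξ)) + 4(1 + 2b_{1,1}ξ)(1 − 𝐛₁(ξ))². -/
noncomputable def Fg (g : ℕ) : Polynomial (Bg g) :=
  Polynomial.X * (Bcoef g 2) ^ 2 + 2 * Polynomial.X * Bcoef g 3 * (1 - Bcoef g 1)
    + 4 * (1 + 2 * Polynomial.C (bb g 1 1) * Polynomial.X) * (1 - Bcoef g 1) ^ 2

/-- `lam g m` is λ_{2m+2}, defined by 4λ_{2m+2} = coefficient of ξ^{m+1} in `Fg g`. -/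
noncomputable def lam (g m : ℕ) : Bg g := ((1 : ℂ) / 4) • ((Fg g).coeff (m + 1))

/-- The polynomial vector field D₁ on B_g:
D₁(b_{1,j}) = b_{2,j}, D₁(b_{2,j}) = b_{3,j},
D₁(b_{3,j}) = 4(2b_{1,1}b_{2,j} + b_{2,1}b_{1,j} + b_{2,j+2}) (with b_{2,2g+1} = 0). -/
noncomputable def D1g (g : ℕ) : Derivation ℂ (Bg g) (Bg g) :=
  MvPolynomial.mkDerivation ℂ (fun v : Fin 3 × Fin g =>
    if (v.1 : ℕ) = 0 then bb g 2 ((v.2 : ℕ) + 1)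
    else if (v.1 : ℕ) = 1 then bb g 3 ((v.2 : ℕ) + 1)
    else 4 * (2 * bb g 1 1 * bb g 2 ((v.2 : ℕ) + 1) + bb g 2 1 * bb g 1 ((v.2 : ℕ) + 1)
      + bb g 2 ((v.2 : ℕ) + 2)))

/-- The polynomial vector field D_s on B_g (for odd s ≥ 3):
D_s(b_{i,j}) = (1/2)·D₁ⁱ(p_{s,j}); for s = 1 it is D₁.  (For s = 2g+1 the
conventions p_{s,j} = 0 make it the zero vector field.) -/
noncomputable def Dsg (g s : ℕ) : Derivation ℂ (Bg g) (Bg g) :=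
  if s = 1 then D1g g else
  MvPolynomial.mkDerivation ℂ (fun v : Fin 3 × Fin g =>
    ((1 : ℂ) / 2) • (((D1g g).toLinearMap ^ ((v.1 : ℕ) + 1)) (pp g s (2 * (v.2 : ℕ) + 1))))

/-- The multiplication operator by c ∈ B_g. -/
noncomputable def mulBg (g : ℕ) (c : Bg g) : Module.End ℂ (Bg g) := LinearMap.mulLeft ℂ c

/-- D_s as a ℂ-linear endomorphism of B_g. -/
noncomputable def DLg (g s : ℕ) : Module.End ℂ (Bg g) := (Dsg g s).toLinearMap

/-- ℒ = D₁² − 2b_{1,1}. -/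
noncomputable def Lg (g : ℕ) : Module.End ℂ (Bg g) := DLg g 1 ^ 2 - mulBg g (2 * bb g 1 1)

/-- The Buchstaber–Shorina polynomial differential operator
ℬ_{2k+1} = D_{2k−1}D₁² − (b_{1,1}D_{2k−1} + D_{2k−1}b_{1,1})
  − (1/2)(b_{1,2k−1}D₁ + D₁b_{1,2k−1}) − D_{2k+1}. -/
noncomputable def Bopg (g k : ℕ) : Module.End ℂ (Bg g) :=
  DLg g (2 * k - 1) * DLg g 1 ^ 2
    - (mulBg g (bb g 1 1) * DLg g (2 * k - 1) + DLg g (2 * k - 1) * mulBg g (bb g 1 1))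
    - ((1 : ℂ) / 2) • (mulBg g (bv g 1 (2 * k - 1)) * DLg g 1 + DLg g 1 * mulBg g (bv g 1 (2 * k - 1)))
    - DLg g (2 * k + 1)

/-- σ : B_g → B_j, the ℂ-algebra homomorphism with σ(b_{i,l}) = b_{i,l} for
odd l ≤ 2j−1 and σ(b_{i,l}) = 0 for odd l with 2j−1 < l ≤ 2g−1. -/
noncomputable def sg (g j : ℕ) : Bg g →ₐ[ℂ] Bg j :=
  MvPolynomial.aeval (fun v : Fin 3 × Fin g =>
    if h : (v.2 : ℕ) < j then (MvPolynomial.X (v.1, ⟨(v.2 : ℕ), h⟩) : Bg j) else 0)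

theorem bb_eq_zero {g m : ℕ} (i : ℕ) (h : g < m) : bb g i m = 0 :=
  dif_neg (by omega)

theorem Qg_eq_zero (g a c : ℕ) (h : g < c) : Qg g a c = 0 := by
  have b0 (i : ℕ) : bb g i c = 0 := bb_eq_zero i h
  have b1 (i : ℕ) : bb g i (c + 1) = 0 := bb_eq_zero i (by omega)
  have b2 (i : ℕ) : bb g i (c + 2) = 0 := bb_eq_zero i (by omega)
  match a with
  | 0 => simp [Qg]
  | 1 | 2 | 3 => simp [Qg, b0, b1, b2]
  | a + 4 =>
    simp [Qg, b0, b1, show ¬ c + 1 ≤ g by omega, show ¬ c + 2 ≤ g by omega]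

/-- The recursion for `Qg` without the case distinctions on the second index. -/
theorem Qg_add_four (g a c : ℕ) : Qg g (a + 4) c =
    2 * Qg g (a + 3) (c + 1) - Qg g (a + 2) (c + 2)
      - 8 * bb g 1 1 * bb g 1 (a + 2) * bb g 1 c - 2 * bb g 1 c * bb g 1 (a + 3)
      - 2 * bb g 1 (a + 2) * bb g 1 (c + 1) + bb g 1 (a + 2) * bb g 3 c
      - bb g 2 (a + 2) * bb g 2 c + bb g 3 (a + 2) * bb g 1 c := by
  have h1 : (if c + 1 ≤ g then Qg g (a + 3) (c + 1) else 0) = Qg g (a + 3) (c + 1) :=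
    ite_eq_left_iff.mpr fun h => (Qg_eq_zero _ _ _ (by omega)).symm
  have h2 : (if c + 2 ≤ g then Qg g (a + 2) (c + 2) else 0) = Qg g (a + 2) (c + 2) :=
    ite_eq_left_iff.mpr fun h => (Qg_eq_zero _ _ _ (by omega)).symm
  rw [Qg, h1, h2]

theorem sg_X (g j : ℕ) (v : Fin 3 × Fin g) :
    sg g j (X v) = bb j ((v.1 : ℕ) + 1) ((v.2 : ℕ) + 1) := by
  have := v.1.isLt
  by_cases h : (v.2 : ℕ) < j
  · have h' : 1 ≤ (v.1 : ℕ) + 1 ∧ (v.1 : ℕ) + 1 ≤ 3 ∧ 1 ≤ (v.2 : ℕ) + 1 ∧ (v.2 : ℕ) + 1 ≤ j := by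
      omega
    simp [sg, bb, h, h']
  · rw [bb_eq_zero _ (by omega)]
    simp [sg, h]

theorem sg_bb {g j : ℕ} (hjg : j ≤ g) (i m : ℕ) : sg g j (bb g i m) = bb j i m := by
  by_cases h : 1 ≤ i ∧ i ≤ 3 ∧ 1 ≤ m ∧ m ≤ g
  · rw [bb, dif_pos h, sg_X]
    congr 1 <;> dsimp only <;> omega
  · rw [bb, dif_neg h, map_zero, bb, dif_neg (by omega)]

theorem sg_bv {g j : ℕ} (hjg : j ≤ g) (i l : ℕ) : sg g j (bv g i l) = bv j i l := by
  unfold bv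
  split_ifs
  · exact sg_bb hjg _ _
  · exact map_zero _

theorem sg_Qg {g j : ℕ} (hjg : j ≤ g) (a c : ℕ) : sg g j (Qg g a c) = Qg j a c := by
  induction a using Nat.strong_induction_on generalizing c with
  | _ a ih =>
    match a with
    | 0 | 1 | 2 | 3 => simp [Qg, sg_bb hjg, map_ofNat]
    | a + 4 =>
      simp [Qg_add_four, sg_bb hjg, map_ofNat, ih (a + 3) (by omega), ih (a + 2) (by omega)]

theorem sg_pp {g j : ℕ} (hj : 1 ≤ j) (hjg : j ≤ g) (k l : ℕ) :
    sg g j (pp g k l) = pp j k l := by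
  by_cases hg : Odd k ∧ Odd l ∧ k ≤ 2 * g - 1 ∧ l ≤ 2 * g - 1
  · rw [pp, if_pos hg, apply_ite (sg g j), sg_Qg hjg, sg_Qg hjg, pp]
    by_cases hb : Odd k ∧ Odd l ∧ k ≤ 2 * j - 1 ∧ l ≤ 2 * j - 1
    · rw [if_pos hb]
    · rw [if_neg hb]
      have hkl : ¬ (k ≤ 2 * j - 1 ∧ l ≤ 2 * j - 1) := fun h => hb ⟨hg.1, hg.2.1, h⟩
      have := Nat.odd_iff.mp hg.1
      have := Nat.odd_iff.mp hg.2.1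
      split_ifs <;> exact Qg_eq_zero _ _ _ (by omega)
  · rw [pp, if_neg hg, map_zero, pp, if_neg fun h => hg ⟨h.1, h.2.1, by omega, by omega⟩]

/-- An algebra homomorphism intertwines two derivations as soon as it does so on the variables. -/
theorem map_derivation_of_X {R σ A : Type*} [CommRing R] [CommRing A] [Algebra R A]
    (φ : MvPolynomial σ R →ₐ[R] A)
    (D : Derivation R (MvPolynomial σ R) (MvPolynomial σ R)) (E : Derivation R A A)
    (h : ∀ v, φ (D (X v)) = E (φ (X v))) (f : MvPolynomial σ R) : φ (D f) = E (φ f) := by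
  induction f using MvPolynomial.induction_on with
  | C a => simp [← MvPolynomial.algebraMap_eq]
  | add p q hp hq => simp [hp, hq]
  | mul_X p v hp => simp [hp, h]

theorem D1g_bb_one (g m : ℕ) : D1g g (bb g 1 m) = bb g 2 m := by
  by_cases h : 1 ≤ m ∧ m ≤ g
  · simp [bb, D1g, h]
  · simp [bb, h]

theorem D1g_bb_two (g m : ℕ) : D1g g (bb g 2 m) = bb g 3 m := by
  by_cases h : 1 ≤ m ∧ m ≤ g
  · simp [bb, D1g, h]
  · simp [bb, h]

theorem D1g_bb_three (g m : ℕ) (hm : 1 ≤ m) : D1g g (bb g 3 m) =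
    4 * (2 * bb g 1 1 * bb g 2 m + bb g 2 1 * bb g 1 m + bb g 2 (m + 1)) := by
  by_cases h : m ≤ g
  · rw [bb, dif_pos ⟨by omega, by omega, hm, h⟩, D1g, mkDerivation_X]
    simp [Nat.sub_add_cancel hm, show m - 1 + 2 = m + 1 by omega]
  · simp [bb_eq_zero _ (show g < m by omega), bb_eq_zero _ (show g < m + 1 by omega)]

theorem sg_D1g {g j : ℕ} (hjg : j ≤ g) (f : Bg g) :
    sg g j (D1g g f) = D1g j (sg g j f) := by
  refine map_derivation_of_X _ _ _ (fun v => ?_) f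
  rw [sg_X, D1g, mkDerivation_X]
  obtain ⟨i, m⟩ := v
  fin_cases i
  · simp [sg_bb hjg, D1g_bb_one]
  · simp [sg_bb hjg, D1g_bb_two]
  · simp [sg_bb hjg, D1g_bb_three, map_ofNat]

theorem sg_D1g_pow {g j : ℕ} (hjg : j ≤ g) (n : ℕ) (f : Bg g) :
    sg g j (((D1g g).toLinearMap ^ n) f) = ((D1g j).toLinearMap ^ n) (sg g j f) := by
  induction n with
  | zero => rfl
  | succ n ih =>
    rw [pow_succ', pow_succ', Module.End.mul_apply, Module.End.mul_apply, ← ih]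
    exact sg_D1g hjg _

theorem pp_eq_zero {g l : ℕ} (k : ℕ) (h : 2 * g - 1 < l) : pp g k l = 0 :=
  if_neg (by omega)

theorem sg_Dsg {g j : ℕ} (hj : 1 ≤ j) (hjg : j ≤ g) (s : ℕ) (f : Bg g) :
    sg g j (Dsg g s f) = Dsg j s (sg g j f) := by
  by_cases hs : s = 1
  · simpa [Dsg, hs] using sg_D1g hjg f
  refine map_derivation_of_X _ _ _ (fun v => ?_) f
  rw [Dsg, if_neg hs, Dsg, if_neg hs, mkDerivation_X, map_smul, sg_D1g_pow hjg, sg_pp hj hjg]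
  by_cases h : (v.2 : ℕ) < j
  · simp [sg, h]
  · rw [sg_X, bb_eq_zero _ (by omega), pp_eq_zero _ (by omega)]
    simp

theorem sg_DLg {g j : ℕ} (hj : 1 ≤ j) (hjg : j ≤ g) (s : ℕ) (f : Bg g) :
    sg g j (DLg g s f) = DLg j s (sg g j f) :=
  sg_Dsg hj hjg s f

theorem sg_mulBg (g j : ℕ) (c f : Bg g) :
    sg g j (mulBg g c f) = mulBg j (sg g j c) (sg g j f) :=
  map_mul _ _ _

/-- for 1 ≤ j < g, σ ∘ ℒ^{(g)} = ℒ^{(j)} ∘ σ and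
σ ∘ ℬ^{(g)}_{2k+1} = ℬ^{(j)}_{2k+1} ∘ σ for 1 ≤ k ≤ j. -/
theorem stmt11 (g j : ℕ) (hj : 1 ≤ j) (hjg : j < g) :
    (∀ f : Bg g, sg g j (Lg g f) = Lg j (sg g j f)) ∧
    (∀ k, 1 ≤ k → k ≤ j → ∀ f : Bg g, sg g j (Bopg g k f) = Bopg j k (sg g j f)) := by
  refine ⟨fun f => ?_, fun k _ _ f => ?_⟩
  · simp [Lg, pow_two, sg_DLg hj hjg.le, sg_mulBg, sg_bb hjg.le, map_ofNat]
  · simp [Bopg, pow_two, sg_DLg hj hjg.le, sg_mulBg, sg_bb hjg.le, sg_bv hjg.le]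

end
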